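/- N(c) → ∞ as c → ∞: for every nonnegative integer k there exists C_k > 0 such that for every c > C_k the function H(·, c) of the c-orbit has at least k zeros on [0, ρ₁(c)); in fact these k zeros already lie in the interval (0, √(1−2α)). -/

import Mathlib

open Real Filter Set Topology Asymptotics MeasureTheory

noncomputable section

/-- The CSS (continuously self-similar) system for `(H, A, Z)` with derivative
function `H'`, on the interval `(0, ρ₁)`, together with the constraint, the
positivity/range conditions, and the initial conditions at `ρ = 0`:
`H(0) = -π/2`, `H'(0) = c`, `A(0) = 1`, `Z(0) = 0`, `Z'(0) = 1`.  This is the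
notion of a `c`-orbit. -/
structure IsCOrbit (α c : ℝ) (H H' A Z : ℝ → ℝ) (ρ₁ : ℝ) : Prop where
  rho1_pos : 0 < ρ₁
  hH : ∀ ρ ∈ Set.Ioo 0 ρ₁, HasDerivAt H (H' ρ) ρ
  hH' : ∀ ρ ∈ Set.Ioo 0 ρ₁, HasDerivAt H'
      (α * (1 + Z ρ ^ 2) * ρ * H' ρ ^ 3 - (2 / ρ) * H' ρ
        - Real.sin (2 * H ρ) / (A ρ * ρ ^ 2 * (1 - Z ρ ^ 2))) ρ
  hA : ∀ ρ ∈ Set.Ioo 0 ρ₁, HasDerivAt A (-2 * α * ρ * A ρ * H' ρ ^ 2) ρ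
  hZ : ∀ ρ ∈ Set.Ioo 0 ρ₁, HasDerivAt Z
      (Z ρ * (1 + α * (1 - Z ρ ^ 2) * ρ ^ 2 * H' ρ ^ 2) / ρ) ρ
  constraint : ∀ ρ ∈ Set.Ioo 0 ρ₁,
      1 - 2 * α - A ρ + 2 * α * Real.sin (H ρ) ^ 2
        + α * A ρ * ρ ^ 2 * H' ρ ^ 2 * (1 - Z ρ ^ 2) = 0
  hApos : ∀ ρ ∈ Set.Ioo 0 ρ₁, 0 < A ρ
  hZ01 : ∀ ρ ∈ Set.Ioo 0 ρ₁, 0 ≤ Z ρ ∧ Z ρ < 1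
  H0 : H 0 = -(π / 2)
  A0 : A 0 = 1
  Z0 : Z 0 = 0
  Hcont : Tendsto H (𝓝[>] 0) (𝓝 (-(π / 2)))
  H'init : Tendsto H' (𝓝[>] 0) (𝓝 c)
  Acont : Tendsto A (𝓝[>] 0) (𝓝 1)
  Zcont : Tendsto Z (𝓝[>] 0) (𝓝 0)
  Z'init : Tendsto (fun ρ => Z ρ / ρ) (𝓝[>] 0) (𝓝 1)

/-- A function on `(0, r]` with nonpositive derivative is bounded by its limit at `0`. -/
theorem le_of_hasDerivAt_nonpos {f f' : ℝ → ℝ} {L r : ℝ} (hr : 0 < r)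
    (hd : ∀ x ∈ Ioc 0 r, HasDerivAt f (f' x) x) (hn : ∀ x ∈ Ioo 0 r, f' x ≤ 0)
    (hL : Tendsto f (𝓝[>] 0) (𝓝 L)) : f r ≤ L := by
  have hanti : AntitoneOn f (Ioc 0 r) := by
    refine antitoneOn_of_deriv_nonpos (convex_Ioc 0 r)
      (fun x hx => (hd x hx).continuousAt.continuousWithinAt) ?_ ?_
    · intro x hx
      rw [interior_Ioc] at hx
      exact (hd x (Ioo_subset_Ioc_self hx)).differentiableAt.differentiableWithinAt
    · intro x hx
      rw [interior_Ioc] at hx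
      rw [(hd x (Ioo_subset_Ioc_self hx)).deriv]
      exact hn x hx
  refine ge_of_tendsto hL ?_
  filter_upwards [Ioo_mem_nhdsGT hr] with x hx
  exact hanti (Ioo_subset_Ioc_self hx) ⟨hr, le_rfl⟩ hx.2.le

/-- A function that increases wherever it is negative and tends to `0` at `0` is nonnegative. -/
theorem nonneg_of_hasDerivAt_pos_of_neg {f f' : ℝ → ℝ} {r : ℝ} (hr : 0 < r)
    (hd : ∀ x ∈ Ioc 0 r, HasDerivAt f (f' x) x)
    (hp : ∀ x ∈ Ioc 0 r, f x < 0 → 0 < f' x)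
    (hL : Tendsto f (𝓝[>] 0) (𝓝 0)) : 0 ≤ f r := by
  by_contra! hneg
  refine absurd (le_of_tendsto hL (b := f r) ?_) (not_le.mpr hneg)
  filter_upwards [Ioo_mem_nhdsGT hr] with e he
  obtain ⟨m, hm, hmin⟩ := isCompact_Icc.exists_isMinOn (nonempty_Icc.mpr he.2.le)
    (fun x hx => (hd x ⟨he.1.trans_le hx.1, hx.2⟩).continuousAt.continuousWithinAt :
      ContinuousOn f (Icc e r))
  have hmr : f m ≤ f r := hmin (right_mem_Icc.mpr he.2.le)
  rcases hm.1.eq_or_lt with rfl | hem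
  · exact hmr
  · exfalso
    have hm0 : m ∈ Ioc 0 r := ⟨he.1.trans hem, hm.2⟩
    have hpos := hp m hm0 (hmr.trans_lt hneg)
    have hslope := (hasDerivAt_iff_tendsto_slope.mp (hd m hm0)).mono_left
      (nhdsWithin_mono m (fun x (hx : x ∈ Iio m) => ne_of_lt hx))
    obtain ⟨x, hx, hxm⟩ :=
      ((hslope.eventually (lt_mem_nhds hpos)).and (Ioo_mem_nhdsLT hem)).exists
    have hfx : f m ≤ f x := hmin ⟨hxm.1.le, hxm.2.le.trans hm.2⟩
    rw [slope_def_field] at hx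
    have := div_nonpos_of_nonneg_of_nonpos (sub_nonneg.mpr hfx) (sub_nonpos.mpr hxm.2.le)
    linarith

/-- The quadratic form governing the Riccati equation of `ρ H' / tan H` is definite. -/
theorem riccati_bound {b u C B m : ℝ} (hb0 : 0 ≤ b) (hb1 : b ≤ 1) (hC : 0 < C) (hC1 : C ≤ 1)
    (hmC : m ≤ C) (hB : 1 ≤ B) : (m + u ^ 2) / 2 ≤ b * u + 2 * C * B + u ^ 2 / C := by
  have h1 : (C + u ^ 2) / 2 ≤ b * u + 2 * C + u ^ 2 / C := by
    have : b * u + 2 * C + u ^ 2 / C = (b * u * C + 2 * C ^ 2 + u ^ 2) / C := by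
      field_simp
    rw [this, le_div_iff₀ hC]
    nlinarith [sq_nonneg (u + b * C), mul_nonneg (sub_nonneg.mpr hC1) (sq_nonneg u),
      mul_nonneg (sq_nonneg C) (mul_nonneg (sub_nonneg.mpr hb1) (by linarith : 0 ≤ 1 + b))]
  nlinarith

namespace IsCOrbit

variable {α c : ℝ} {H H' A Z : ℝ → ℝ} {ρ₁ : ℝ}

/-- The equation satisfied by `ρ H'`. -/
theorem hasDerivAt_mul_deriv (h : IsCOrbit α c H H' A Z ρ₁) {ρ : ℝ} (hρ : ρ ∈ Ioo 0 ρ₁) :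
    HasDerivAt (fun x => x * H' x)
      ((-((1 - α * (ρ * H' ρ) ^ 2 * (1 + Z ρ ^ 2)) * (ρ * H' ρ))
        - 2 * sin (H ρ) * cos (H ρ) * (A ρ * (1 - Z ρ ^ 2))⁻¹) / ρ) ρ := by
  have h0 : ρ ≠ 0 := hρ.1.ne'
  have hA := (h.hApos ρ hρ).ne'
  have hZ : 1 - Z ρ ^ 2 ≠ 0 := by
    obtain ⟨h1, h2⟩ := h.hZ01 ρ hρ
    nlinarith
  refine ((hasDerivAt_id ρ).mul (h.hH' ρ hρ)).congr_deriv ?_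
  rw [sin_two_mul]
  simp only [id]
  field_simp
  ring

theorem A_le_one (h : IsCOrbit α c H H' A Z ρ₁) (hα0 : 0 < α) {ρ : ℝ} (hρ : ρ ∈ Ioo 0 ρ₁) :
    A ρ ≤ 1 := by
  have hI : ∀ x ∈ Ioc 0 ρ, x ∈ Ioo 0 ρ₁ := fun x hx => ⟨hx.1, hx.2.trans_lt hρ.2⟩
  refine le_of_hasDerivAt_nonpos hρ.1 (fun x hx => h.hA x (hI x hx)) (fun x hx => ?_) h.Acont
  have hx' := hI x (Ioo_subset_Ioc_self hx)
  have := mul_nonneg (mul_nonneg (mul_nonneg hα0.le hx.1.le) (h.hApos x hx').le)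
    (sq_nonneg (H' x))
  linarith

theorem A_antitoneOn (h : IsCOrbit α c H H' A Z ρ₁) (hα0 : 0 < α) :
    AntitoneOn A (Ioo 0 ρ₁) := by
  refine antitoneOn_of_deriv_nonpos (convex_Ioo 0 ρ₁)
    (fun x hx => (h.hA x hx).continuousAt.continuousWithinAt) ?_ ?_ <;>
    rw [interior_Ioo] <;> intro x hx
  · exact (h.hA x hx).differentiableAt.differentiableWithinAt
  · rw [(h.hA x hx).deriv]
    have := mul_nonneg (mul_nonneg (mul_nonneg hα0.le hx.1.le) (h.hApos x hx).le)
      (sq_nonneg (H' x))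
    linarith

theorem A_lt_one (h : IsCOrbit α c H H' A Z ρ₁) (hα0 : 0 < α) (hc : 0 < c) {ρ : ℝ}
    (hρ : ρ ∈ Ioo 0 ρ₁) : A ρ < 1 := by
  refine lt_of_le_of_ne (h.A_le_one hα0 hρ) fun hA1 => ?_
  obtain ⟨x, hx, hxρ⟩ :=
    ((h.H'init.eventually (lt_mem_nhds hc)).and (Ioo_mem_nhdsGT hρ.1)).exists
  have hx' : x ∈ Ioo 0 ρ₁ := ⟨hxρ.1, hxρ.2.trans hρ.2⟩
  have hev : A =ᶠ[𝓝 x] fun _ => 1 := by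
    filter_upwards [Ioo_mem_nhds hxρ.1 hxρ.2] with y hy
    have hy' : y ∈ Ioo 0 ρ₁ := ⟨hy.1, hy.2.trans hρ.2⟩
    exact le_antisymm (h.A_le_one hα0 hy') (hA1 ▸ h.A_antitoneOn hα0 hy' hρ hy.2.le)
  have h0 := (h.hA x hx').unique ((hasDerivAt_const x (1 : ℝ)).congr_of_eventuallyEq hev)
  have := mul_pos (mul_pos (mul_pos hα0 hx'.1) (h.hApos x hx')) (pow_pos hx 2)
  linarith

/-- The constraint bounds `cos² H` from below by `1 - A`. -/
theorem one_sub_A_le (h : IsCOrbit α c H H' A Z ρ₁) (hα0 : 0 < α) {ρ : ℝ}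
    (hρ : ρ ∈ Ioo 0 ρ₁) : 1 - A ρ ≤ 2 * α * cos (H ρ) ^ 2 := by
  have h1 := h.constraint ρ hρ
  obtain ⟨h2, h3⟩ := h.hZ01 ρ hρ
  have h4 : 0 ≤ 1 - Z ρ ^ 2 := by nlinarith
  have h5 : 0 ≤ α * A ρ * ρ ^ 2 * H' ρ ^ 2 * (1 - Z ρ ^ 2) :=
    mul_nonneg (mul_nonneg (mul_nonneg (mul_nonneg hα0.le (h.hApos ρ hρ).le) (sq_nonneg _))
      (sq_nonneg _)) h4
  rw [sin_sq] at h1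
  linarith

theorem le_A (h : IsCOrbit α c H H' A Z ρ₁) (hα0 : 0 < α) {ρ : ℝ}
    (hρ : ρ ∈ Ioo 0 ρ₁) : 1 - 2 * α ≤ A ρ := by
  nlinarith [h.one_sub_A_le hα0 hρ, cos_sq_le_one (H ρ)]

theorem Z_sq_mul_A_le (h : IsCOrbit α c H H' A Z ρ₁) (hα0 : 0 < α) {ρ : ℝ}
    (hρ : ρ ∈ Ioo 0 ρ₁) : Z ρ ^ 2 * A ρ ≤ ρ ^ 2 := by
  have hI : ∀ x ∈ Ioc 0 ρ, x ∈ Ioo 0 ρ₁ := fun x hx => ⟨hx.1, hx.2.trans_lt hρ.2⟩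
  have key : (Z ρ / ρ) ^ 2 * A ρ ≤ 1 := by
    refine le_of_hasDerivAt_nonpos (f := fun x => (Z x / x) ^ 2 * A x)
      (f' := fun x => -(2 * α * x * A x * (H' x * (Z x) * (Z x / x)) ^ 2))
      hρ.1 (fun x hx => ?_) (fun x hx => ?_) ?_
    · have hx0 : x ≠ 0 := hx.1.ne'
      refine ((((h.hZ x (hI x hx)).div (hasDerivAt_id x) hx0).pow 2).mul
        (h.hA x (hI x hx))).congr_deriv ?_
      simp only [id, Pi.div_apply, Pi.pow_apply, Nat.reduceSub, pow_one, Nat.cast_ofNat]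
      field_simp
      ring
    · have := h.hApos x (hI x (Ioo_subset_Ioc_self hx))
      have := hx.1
      rw [neg_nonpos]
      positivity
    · simpa using (h.Z'init.pow 2).mul h.Acont
  rw [div_pow, div_mul_eq_mul_div, div_le_one (pow_pos hρ.1 2)] at key
  exact key

theorem sqrt_le_rho1 (h : IsCOrbit α c H H' A Z ρ₁) (hα0 : 0 < α)
    (hZ : Tendsto Z (𝓝[<] ρ₁) (𝓝 1)) : √(1 - 2 * α) ≤ ρ₁ := by
  have hlim : Tendsto (fun x => Z x ^ 2 * (1 - 2 * α)) (𝓝[<] ρ₁) (𝓝 (1 ^ 2 * (1 - 2 * α))) :=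
    (hZ.pow 2).mul_const _
  have : 1 ^ 2 * (1 - 2 * α) ≤ ρ₁ ^ 2 := by
    refine le_of_tendsto hlim ?_
    filter_upwards [Ioo_mem_nhdsLT h.rho1_pos] with x hx
    have h1 := h.Z_sq_mul_A_le hα0 hx
    have h2 := mul_le_mul_of_nonneg_left (h.le_A hα0 hx) (sq_nonneg (Z x))
    have h3 := pow_le_pow_left₀ hx.1.le hx.2.le 2
    linarith
  exact Real.sqrt_le_iff.mpr ⟨h.rho1_pos.le, by linarith⟩

/-- On `(0, (1 - 2α)/2]` the damping coefficient of the equation for `ρ H'` lies in `[0, 1]`. -/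
theorem damping_mem_Icc (h : IsCOrbit α c H H' A Z ρ₁) (hα0 : 0 < α) (hα : α < 1 / 2) {ρ : ℝ}
    (hρ : ρ ∈ Ioo 0 ρ₁) (hρδ : ρ ≤ (1 - 2 * α) / 2) :
    1 - α * (ρ * H' ρ) ^ 2 * (1 + Z ρ ^ 2) ∈ Icc 0 1 := by
  have hZA := h.Z_sq_mul_A_le hα0 hρ
  have hAl := h.le_A hα0 hρ
  have hA1 := h.A_le_one hα0 hρ
  have hA0 := h.hApos ρ hρ
  have hcon := h.constraint ρ hρ
  have hα' : 0 < 1 - 2 * α := by linarith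
  have hZ4 : Z ρ ^ 2 ≤ (1 - 2 * α) / 4 := by
    have h1 : Z ρ ^ 2 * (1 - 2 * α) ≤ ρ ^ 2 :=
      (mul_le_mul_of_nonneg_left hAl (sq_nonneg _)).trans hZA
    have h2 := pow_le_pow_left₀ hρ.1.le hρδ 2
    have h3 : Z ρ ^ 2 * (1 - 2 * α) ≤ (1 - 2 * α) / 4 * (1 - 2 * α) := by linarith
    exact le_of_mul_le_mul_right h3 hα'
  set z := Z ρ ^ 2 with hz
  have hz0 : 0 ≤ z := sq_nonneg _
  set w := α * (ρ * H' ρ) ^ 2 with hw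
  have hw0 : 0 ≤ w := by positivity
  have hwA : A ρ * (w * (1 - z)) ≤ A ρ * (2 * α) := by
    have h1 : A ρ * (w * (1 - z)) = α * A ρ * ρ ^ 2 * H' ρ ^ 2 * (1 - z) := by rw [hw]; ring
    have h2 : 0 ≤ 2 * α * sin (H ρ) ^ 2 := by positivity
    have h3 : A ρ * (1 - 2 * α) ≤ 1 * (1 - 2 * α) := mul_le_mul_of_nonneg_right hA1 hα'.le
    linarith
  have hwz : w * (1 - z) ≤ 2 * α := le_of_mul_le_mul_left hwA hA0
  have hz1 : 0 < 1 - z := by linarith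
  have hfin : w * (1 + z) ≤ 1 := by
    refine le_of_mul_le_mul_right ?_ hz1
    have h1 : w * (1 - z) * (1 + z) ≤ 2 * α * (1 + z) :=
      mul_le_mul_of_nonneg_right hwz (by linarith)
    have h2 : 2 * α * z ≤ 1 * z := mul_le_mul_of_nonneg_right (by linarith) hz0
    linarith
  have : 0 ≤ w * (1 + z) := mul_nonneg hw0 (by linarith)
  constructor <;> linarith

theorem one_le_inv (h : IsCOrbit α c H H' A Z ρ₁) (hα0 : 0 < α) {ρ : ℝ}
    (hρ : ρ ∈ Ioo 0 ρ₁) : 1 ≤ (A ρ * (1 - Z ρ ^ 2))⁻¹ := by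
  obtain ⟨h1, h2⟩ := h.hZ01 ρ hρ
  have h3 : 0 < 1 - Z ρ ^ 2 := by nlinarith
  exact (one_le_inv₀ (mul_pos (h.hApos ρ hρ) h3)).mpr
    (mul_le_one₀ (h.A_le_one hα0 hρ) h3.le (by nlinarith))

theorem tendsto_cos (h : IsCOrbit α c H H' A Z ρ₁) :
    Tendsto (fun ρ => cos (H ρ)) (𝓝[>] 0) (𝓝 0) := by
  simpa [Function.comp_def] using (continuous_cos.tendsto _).comp h.Hcont

theorem tendsto_sin (h : IsCOrbit α c H H' A Z ρ₁) :
    Tendsto (fun ρ => sin (H ρ)) (𝓝[>] 0) (𝓝 (-1)) := by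
  simpa [Function.comp_def] using (continuous_sin.tendsto _).comp h.Hcont

theorem tendsto_cos_div (h : IsCOrbit α c H H' A Z ρ₁) :
    Tendsto (fun ρ => cos (H ρ) / ρ) (𝓝[>] 0) (𝓝 c) := by
  refine HasDerivAt.lhopital_zero_nhdsGT (f' := fun ρ => -sin (H ρ) * H' ρ) (g' := fun _ => 1)
    ?_ ?_ ?_ h.tendsto_cos (tendsto_id.mono_left nhdsWithin_le_nhds) ?_
  · filter_upwards [Ioo_mem_nhdsGT h.rho1_pos] with x hx
    exact (h.hH x hx).cos
  · exact Eventually.of_forall fun x => hasDerivAt_id x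
  · exact Eventually.of_forall fun _ => one_ne_zero
  · simpa using h.tendsto_sin.neg.mul h.H'init

theorem H_mem_Ioo (h : IsCOrbit α c H H' A Z ρ₁) (hα0 : 0 < α) (hc : 0 < c) {ρ : ℝ}
    (hρ : ρ ∈ Ioo 0 ρ₁) : H ρ ∈ Ioo (-(π / 2)) (π / 2) := by
  have hne : ∀ x ∈ Ioo 0 ρ₁, cos (H x) ≠ 0 := fun x hx h0 => by
    have := h.one_sub_A_le hα0 hx
    have := h.A_lt_one hα0 hc hx
    simp only [h0] at *
    linarith
  obtain ⟨x, ⟨hx1, hx2⟩, hx⟩ := (((h.tendsto_cos_div.eventually (lt_mem_nhds hc)).and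
    (h.Hcont.eventually (Ioo_mem_nhds (by linarith [pi_pos] : -(π / 2) - π < -(π / 2))
      (by linarith [pi_pos] : -(π / 2) < π / 2)))).and (Ioo_mem_nhdsGT h.rho1_pos)).exists
  have hcos : 0 < cos (H x) := (div_pos_iff_of_pos_right hx.1).mp hx1
  have hHx : -(π / 2) < H x := by
    by_contra! hle
    have := cos_nonpos_of_pi_div_two_le_of_le (x := -H x) (by linarith) (by linarith [hx2.1])
    rw [cos_neg] at this
    linarith
  have hoc : (H '' Ioo 0 ρ₁).OrdConnected :=
    (isPreconnected_Ioo.image H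
      fun y hy => (h.hH y hy).continuousAt.continuousWithinAt).ordConnected
  constructor
  · by_contra! hle
    obtain ⟨y, hy, hyH⟩ := hoc.out (mem_image_of_mem H hρ) (mem_image_of_mem H hx) ⟨hle, hHx.le⟩
    exact hne y hy (by rw [hyH]; simp)
  · by_contra! hle
    obtain ⟨y, hy, hyH⟩ := hoc.out (mem_image_of_mem H hx) (mem_image_of_mem H hρ)
      ⟨hx2.2.le, hle⟩
    exact hne y hy (by rw [hyH]; simp)

/-- As long as `H < -π/4`, the profile moves at least as fast as `-sin H cos H`. -/
theorem mul_deriv_add_sin_mul_cos_nonneg (h : IsCOrbit α c H H' A Z ρ₁) (hα0 : 0 < α)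
    (hα : α < 1 / 2) (hc : 0 < c) {ρ : ℝ} (hρ : ρ ∈ Ioo 0 ρ₁) (hρδ : ρ ≤ (1 - 2 * α) / 2)
    (hH : ∀ x ∈ Ioc 0 ρ, H x < -(π / 4)) : 0 ≤ ρ * H' ρ + sin (H ρ) * cos (H ρ) := by
  have hI : ∀ x ∈ Ioc 0 ρ, x ∈ Ioo 0 ρ₁ := fun x hx => ⟨hx.1, hx.2.trans_lt hρ.2⟩
  refine nonneg_of_hasDerivAt_pos_of_neg (f := fun x => x * H' x + sin (H x) * cos (H x))
    hρ.1 (fun x hx => (h.hasDerivAt_mul_deriv (hI x hx)).add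
      ((h.hH x (hI x hx)).sin.mul (h.hH x (hI x hx)).cos)) ?_ ?_
  · intro x hx hneg
    have hx' := hI x hx
    have hx0 := hx.1
    obtain ⟨hb0, hb1⟩ := h.damping_mem_Icc hα0 hα hx' (hx.2.trans hρδ)
    have hB := h.one_le_inv hα0 hx'
    obtain ⟨hl, -⟩ := h.H_mem_Ioo hα0 hc hx'
    have hu := hH x hx
    have hcos : 0 < cos (H x) := cos_pos_of_mem_Ioo ⟨hl, by linarith [pi_pos]⟩
    have hsin : sin (H x) < 0 := sin_neg_of_neg_of_neg_pi_lt (by linarith [pi_pos])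
      (by linarith [pi_pos])
    have hcs : cos (H x) ^ 2 ≤ sin (H x) ^ 2 := by
      have : cos (2 * H x) ≤ 0 := by
        have := cos_nonpos_of_pi_div_two_le_of_le (x := -(2 * H x)) (by linarith)
          (by linarith)
        rwa [cos_neg] at this
      rw [cos_two_mul'] at this
      linarith
    have h1 := sin_sq_add_cos_sq (H x)
    have hs : 0 < -(sin (H x) * cos (H x)) := by nlinarith
    set b := 1 - α * (x * H' x) ^ 2 * (1 + Z x ^ 2)
    set B := (A x * (1 - Z x ^ 2))⁻¹
    have hrw : (-(b * (x * H' x)) - 2 * sin (H x) * cos (H x) * B) / x +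
        (cos (H x) * H' x * cos (H x) + sin (H x) * (-sin (H x) * H' x))
        = (2 * -(sin (H x) * cos (H x)) * B
            - (b + (sin (H x) ^ 2 - cos (H x) ^ 2)) * (x * H' x)) / x := by
      field_simp
      ring
    rw [hrw]
    apply div_pos _ hx0
    set s := -(sin (H x) * cos (H x)) with hsdef
    have hvs : x * H' x < s := by linarith
    have hBs : 2 * s ≤ 2 * s * B := le_mul_of_one_le_right (by linarith) hB
    set e := b + (sin (H x) ^ 2 - cos (H x) ^ 2)
    have he0 : 0 ≤ e := by linarith
    have he2 : e ≤ 2 := by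
      have := sq_nonneg (cos (H x))
      linarith
    rcases le_or_gt (x * H' x) 0 with hv | hv
    · nlinarith
    · nlinarith
  · have hsc : Tendsto (fun x => sin (H x) * cos (H x)) (𝓝[>] 0) (𝓝 0) := by
      simpa using h.tendsto_sin.mul h.tendsto_cos
    have hid : Tendsto (fun x : ℝ => x) (𝓝[>] 0) (𝓝 0) :=
      tendsto_id.mono_left nhdsWithin_le_nhds
    simpa using (hid.mul h.H'init).add hsc

/-- The profile leaves the neighbourhood of `-π/2` by `ρ = 1 / c`. -/
theorem exists_neg_pi_div_four_le (h : IsCOrbit α c H H' A Z ρ₁) (hα0 : 0 < α)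
    (hα : α < 1 / 2) (hc : 0 < c) (hcρ : c⁻¹ < ρ₁) (hcδ : c⁻¹ ≤ (1 - 2 * α) / 2) :
    ∃ x ∈ Ioc 0 c⁻¹, -(π / 4) ≤ H x := by
  by_contra! hH
  have hc' : 0 < c⁻¹ := inv_pos.mpr hc
  have hI : ∀ x ∈ Ioc 0 c⁻¹, x ∈ Ioo 0 ρ₁ := fun x hx => ⟨hx.1, hx.2.trans_lt hcρ⟩
  have hsin : ∀ x ∈ Ioc 0 c⁻¹, sin (H x) < 0 := fun x hx =>
    sin_neg_of_neg_of_neg_pi_lt (by linarith [pi_pos, hH x hx])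
      (by linarith [pi_pos, (h.H_mem_Ioo hα0 hc (hI x hx)).1])
  have key : cos (H c⁻¹) / c⁻¹ / sin (H c⁻¹) ≤ c / (-1) := by
    refine le_of_hasDerivAt_nonpos (f := fun x => cos (H x) / x / sin (H x))
      (f' := fun x => -(x * H' x + sin (H x) * cos (H x)) / (x * sin (H x)) ^ 2)
      hc' (fun x hx => ?_) (fun x hx => ?_) ?_
    · have hx0 : x ≠ 0 := hx.1.ne'
      have hs0 := (hsin x hx).ne
      refine ((((h.hH x (hI x hx)).cos).div (hasDerivAt_id x) hx0).div
        (h.hH x (hI x hx)).sin hs0).congr_deriv ?_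
      simp only [id, Pi.div_apply]
      field_simp
      linear_combination -(x * H' x) * sin_sq_add_cos_sq (H x)
    · refine div_nonpos_of_nonpos_of_nonneg (neg_nonpos.mpr ?_) (sq_nonneg _)
      exact h.mul_deriv_add_sin_mul_cos_nonneg hα0 hα hc (hI x (Ioo_subset_Ioc_self hx))
        (hx.2.le.trans hcδ) fun y hy => hH y ⟨hy.1, hy.2.trans hx.2.le⟩
    · exact h.tendsto_cos_div.div h.tendsto_sin (by norm_num)
  have hmem : c⁻¹ ∈ Ioc 0 c⁻¹ := ⟨hc', le_rfl⟩
  have hs := hsin _ hmem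
  have hu := hH _ hmem
  have hl := (h.H_mem_Ioo hα0 hc (hI _ hmem)).1
  have hcs : cos (H c⁻¹) ^ 2 < sin (H c⁻¹) ^ 2 := by
    have := cos_neg_of_pi_div_two_lt_of_lt (x := -(2 * H c⁻¹)) (by linarith) (by linarith)
    rw [cos_neg, cos_two_mul'] at this
    linarith
  rw [div_inv_eq_mul, div_neg, div_one, div_le_iff_of_neg hs] at key
  have hge : -sin (H c⁻¹) ≤ cos (H c⁻¹) := le_of_mul_le_mul_right (by linarith) hc
  nlinarith

/-- By `ρ = 1 / c` the function `A` has dropped below a constant independent of `c`. -/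
theorem A_le_exp (h : IsCOrbit α c H H' A Z ρ₁) (hα0 : 0 < α)
    (hα : α < 1 / 2) (hc : 0 < c) (hcρ : c⁻¹ < ρ₁) (hcδ : c⁻¹ ≤ (1 - 2 * α) / 2) :
    A c⁻¹ ≤ exp (-(α / 2)) := by
  obtain ⟨x₀, hx₀, hHx₀⟩ := h.exists_neg_pi_div_four_le hα0 hα hc hcρ hcδ
  have hI : ∀ x ∈ Ioc 0 c⁻¹, x ∈ Ioo 0 ρ₁ := fun x hx => ⟨hx.1, hx.2.trans_lt hcρ⟩
  obtain ⟨e, he, hHe⟩ := mem_nhdsGT_iff_exists_Ioo_subset.mp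
    (h.Hcont.eventually (gt_mem_nhds (by linarith [pi_pos] : -(π / 2) < -(π / 4))))
  have he : 0 < e := he
  have hex₀ : e ≤ x₀ := by
    by_contra! hlt
    have : H x₀ < -(π / 4) := hHe ⟨hx₀.1, hlt⟩
    linarith
  have hcont : ContinuousOn H (Icc e x₀) := fun x hx =>
    (h.hH x (hI x ⟨he.trans_le hx.1, hx.2.trans hx₀.2⟩)).continuousAt.continuousWithinAt
  obtain ⟨r, hr, hrmin⟩ := (isCompact_Icc.of_isClosed_subset
    (hcont.preimage_isClosed_of_isClosed isClosed_Icc (isClosed_Ici (a := -(π / 4))))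
    inter_subset_left).exists_isLeast ⟨x₀, ⟨hex₀, le_rfl⟩, hHx₀⟩
  have hr0 : 0 < r := he.trans_le hr.1.1
  have hrc : r ≤ c⁻¹ := hr.1.2.trans hx₀.2
  have hHr : -(π / 4) ≤ H r := hr.2
  have hbefore : ∀ x ∈ Ioo 0 r, H x < -(π / 4) := fun x hx => by
    rcases lt_or_ge x e with hxe | hxe
    · exact hHe ⟨hx.1, hxe⟩
    · by_contra! hle
      exact absurd (hrmin ⟨⟨hxe, hx.2.le.trans hr.1.2⟩, hle⟩) (not_le.mpr hx.2)
  have hHr' : H r = -(π / 4) := by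
    refine le_antisymm ?_ hHr
    refine le_of_tendsto (((h.hH r (hI r ⟨hr0, hrc⟩)).continuousAt.tendsto).mono_left
      (nhdsWithin_le_nhds (s := Iio r))) ?_
    filter_upwards [Ioo_mem_nhdsLT hr0] with x hx
    exact (hbefore x hx).le
  have key : log (A r) + α * cos (H r) ^ 2 ≤ log 1 + α * 0 ^ 2 := by
    refine le_of_hasDerivAt_nonpos (f := fun x => log (A x) + α * cos (H x) ^ 2)
      (f' := fun x => -(2 * α * H' x * (x * H' x + sin (H x) * cos (H x))))
      hr0 (fun x hx => ?_) (fun x hx => ?_) ?_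
    · have hx' := hI x ⟨hx.1, hx.2.trans hrc⟩
      have hA := (h.hApos x hx').ne'
      refine (((h.hA x hx').log hA).add (((h.hH x hx').cos.pow 2).const_mul α)).congr_deriv ?_
      field_simp
      ring
    · have hx' := hI x ⟨hx.1, hx.2.le.trans hrc⟩
      have hG := h.mul_deriv_add_sin_mul_cos_nonneg hα0 hα hc hx'
        ((hx.2.le.trans hrc).trans hcδ) fun y hy => hbefore y ⟨hy.1, hy.2.trans_lt hx.2⟩
      have hu := hbefore x hx
      have hl := (h.H_mem_Ioo hα0 hc hx').1
      have hcos : 0 < cos (H x) := cos_pos_of_mem_Ioo ⟨hl, by linarith [pi_pos]⟩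
      have hsin : sin (H x) < 0 := sin_neg_of_neg_of_neg_pi_lt (by linarith [pi_pos])
        (by linarith [pi_pos])
      have hv : 0 < H' x := by
        have := mul_pos_of_neg_of_neg hsin (neg_neg_of_pos hcos)
        exact pos_of_mul_pos_right (a := x) (by linarith) hx.1.le
      rw [neg_nonpos]
      positivity
    · exact (h.Acont.log one_ne_zero).add ((h.tendsto_cos.pow 2).const_mul α)
  have hmono := h.A_antitoneOn hα0 (hI r ⟨hr0, hrc⟩) (hI c⁻¹ ⟨inv_pos.mpr hc, le_rfl⟩) hrc
  refine hmono.trans ((log_le_iff_le_exp (h.hApos r (hI r ⟨hr0, hrc⟩))).mp ?_)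
  rw [hHr', cos_neg, cos_pi_div_four, div_pow, sq_sqrt zero_le_two] at key
  norm_num at key
  linarith

/-- Each interval of fixed logarithmic length on which `cos² H` is bounded below and the damping
coefficient lies in `[0, 1]` contains a zero of `H`. -/
theorem exists_zero (h : IsCOrbit α c H H' A Z ρ₁) (hα0 : 0 < α) (hα : α < 1 / 2) (hc : 0 < c)
    {a b m : ℝ} (ha : 0 < a) (hab : a < b) (hb : b < ρ₁) (hbδ : b ≤ (1 - 2 * α) / 2)
    (hm : 0 < m) (hmc : ∀ ρ ∈ Icc a b, m ≤ cos (H ρ) ^ 2)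
    (hlog : 2 * π / √m ≤ log b - log a) : ∃ ρ ∈ Icc a b, H ρ = 0 := by
  by_contra! hne
  have hI : ∀ x ∈ Icc a b, x ∈ Ioo 0 ρ₁ := fun x hx =>
    ⟨ha.trans_le hx.1, hx.2.trans_lt hb⟩
  have hsm : 0 < √m := sqrt_pos.mpr hm
  have hsin : ∀ x ∈ Icc a b, sin (H x) ≠ 0 := fun x hx h0 => by
    obtain ⟨h1, h2⟩ := h.H_mem_Ioo hα0 hc (hI x hx)
    exact hne x hx ((sin_eq_zero_iff_of_lt_of_lt (by linarith [pi_pos])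
      (by linarith [pi_pos])).mp h0)
  set u : ℝ → ℝ := fun x => x * H' x * cos (H x) / sin (H x) with hu
  set b' : ℝ → ℝ := fun x => 1 - α * (x * H' x) ^ 2 * (1 + Z x ^ 2) with hb'
  set B : ℝ → ℝ := fun x => (A x * (1 - Z x ^ 2))⁻¹ with hB
  have hud : ∀ x ∈ Icc a b, HasDerivAt u
      (-(b' x * u x + 2 * cos (H x) ^ 2 * B x + u x ^ 2 / cos (H x) ^ 2) / x) x := by
    intro x hx
    have hx' := hI x hx
    have hx0 : x ≠ 0 := hx'.1.ne'
    have hs := hsin x hx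
    have hcos : cos (H x) ≠ 0 := (cos_pos_of_mem_Ioo (h.H_mem_Ioo hα0 hc hx')).ne'
    have hd := h.hasDerivAt_mul_deriv hx'
    rw [show (1 - α * (x * H' x) ^ 2 * (1 + Z x ^ 2)) = b' x from rfl,
      show (A x * (1 - Z x ^ 2))⁻¹ = B x from rfl] at hd
    refine ((hd.mul (h.hH x hx').cos).div (h.hH x hx').sin hs).congr_deriv ?_
    simp only [hu, Pi.mul_apply]
    generalize b' x = β
    generalize B x = γ
    field_simp
    linear_combination -(x * H' x) ^ 2 * sin_sq_add_cos_sq (H x)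
  set F : ℝ → ℝ := fun x => arctan (u x / √m) + √m / 2 * log x with hF
  have hFd : ∀ x ∈ Icc a b, HasDerivAt F
      (1 / (1 + (u x / √m) ^ 2) * (-(b' x * u x + 2 * cos (H x) ^ 2 * B x
        + u x ^ 2 / cos (H x) ^ 2) / x / √m) + √m / 2 * x⁻¹) x := fun x hx =>
    (((hud x hx).div_const √m).arctan).add ((hasDerivAt_log (hI x hx).1.ne').const_mul _)
  have hanti : AntitoneOn F (Icc a b) := by
    refine antitoneOn_of_deriv_nonpos (convex_Icc a b)
      (fun x hx => (hFd x hx).continuousAt.continuousWithinAt) ?_ ?_ <;>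
      intro x hx <;> rw [interior_Icc] at hx
    · exact (hFd x (Ioo_subset_Icc_self hx)).differentiableAt.differentiableWithinAt
    · have hx := Ioo_subset_Icc_self hx
      rw [(hFd x hx).deriv]
      have hx' := hI x hx
      obtain ⟨hb0, hb1⟩ := h.damping_mem_Icc hα0 hα hx' (hx.2.trans hbδ)
      have hq := riccati_bound (u := u x) hb0 hb1 (hm.trans_le (hmc x hx))
        (cos_sq_le_one (H x)) (hmc x hx) (h.one_le_inv hα0 hx')
      rw [show (1 - α * (x * H' x) ^ 2 * (1 + Z x ^ 2)) = b' x from rfl,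
        show (A x * (1 - Z x ^ 2))⁻¹ = B x from rfl] at hq
      set Q := b' x * u x + 2 * cos (H x) ^ 2 * B x + u x ^ 2 / cos (H x) ^ 2
      have hx0 := hx'.1
      have hmu : 0 < m + u x ^ 2 := by positivity
      have hsq : √m ^ 2 = m := sq_sqrt hm.le
      have hrw : 1 / (1 + (u x / √m) ^ 2) * (-Q / x / √m) + √m / 2 * x⁻¹
          = √m * ((m + u x ^ 2) / 2 - Q) / (x * (m + u x ^ 2)) := by
        rw [div_pow, hsq]
        field_simp
        rw [hsq]
        ring
      rw [hrw]
      exact div_nonpos_of_nonpos_of_nonneg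
        (mul_nonpos_of_nonneg_of_nonpos hsm.le (by linarith)) (by positivity)
  have hle := hanti (left_mem_Icc.mpr hab.le) (right_mem_Icc.mpr hab.le) hab.le
  have h1 := arctan_lt_pi_div_two (u a / √m)
  have h2 := neg_pi_div_two_lt_arctan (u b / √m)
  rw [div_le_iff₀ hsm] at hlog
  simp only [hF] at hle
  linarith

end IsCOrbit

/-- Proposition 7: `N(c) → ∞` as `c → ∞`; for every `k` there is `C_k > 0`
such that for `c > C_k` the function `H(·, c)` has at least `k` zeros, all of
them already in the interval `(0, √(1-2α))` (which lies inside `[0, ρ₁(c))`). -/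
theorem proposition7 (α : ℝ) (hα0 : 0 < α) (hα : α < 1 / 2) (k : ℕ) :
    ∃ Ck > (0:ℝ), ∀ c, Ck < c →
      ∀ (H H' A Z : ℝ → ℝ) (ρ₁ : ℝ),
        IsCOrbit α c H H' A Z ρ₁ → Tendsto Z (𝓝[<] ρ₁) (𝓝 1) →
        ∃ S : Finset ℝ, S.card = k ∧
          ∀ ρ ∈ S, ρ ∈ Set.Ioo 0 (Real.sqrt (1 - 2 * α)) ∧ H ρ = 0 := by
  set m : ℝ := (1 - exp (-(α / 2))) / (2 * α) with hm
  have hm0 : 0 < m := by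
    have : exp (-(α / 2)) < 1 := exp_lt_one_iff.mpr (by linarith)
    exact div_pos (by linarith) (by linarith)
  set T : ℝ := 2 * π / √m with hT
  have hT0 : 0 < T := div_pos (by linarith [pi_pos]) (sqrt_pos.mpr hm0)
  set δ : ℝ := (1 - 2 * α) / 2 with hδ
  have hδ0 : 0 < δ := by rw [hδ]; linarith
  refine ⟨exp (2 * k * T) / δ, by positivity, fun c hc H H' A Z ρ₁ h hZ => ?_⟩
  have hc0 : 0 < c := lt_trans (by positivity) hc
  have hδs : δ < √(1 - 2 * α) := by
    refine Real.lt_sqrt_of_sq_lt ?_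
    rw [hδ]
    nlinarith
  have hδρ : δ < ρ₁ := hδs.trans_le (h.sqrt_le_rho1 hα0 hZ)
  have hscale : c⁻¹ * exp (2 * k * T) ≤ δ := by
    rw [div_lt_iff₀ hδ0] at hc
    rw [inv_mul_le_iff₀ hc0]
    exact hc.le
  have hcinv : 0 < c⁻¹ := inv_pos.mpr hc0
  have hcδ : c⁻¹ ≤ δ :=
    (le_mul_of_one_le_right hcinv.le (one_le_exp (by positivity))).trans hscale
  have hA := h.A_le_exp hα0 hα hc0 (hcδ.trans_lt hδρ) hcδ
  have hzero : ∀ j : Fin k, ∃ ρ ∈ Icc (c⁻¹ * exp (2 * (j : ℕ) * T))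
      (c⁻¹ * exp ((2 * (j : ℕ) + 1) * T)), H ρ = 0 := by
    intro j
    have hjk : ((j : ℕ) : ℝ) + 1 ≤ k := by exact_mod_cast j.2
    have hbδ : c⁻¹ * exp ((2 * (j : ℕ) + 1) * T) ≤ δ := by
      refine le_trans ?_ hscale
      gcongr
      linarith
    have ha : c⁻¹ ≤ c⁻¹ * exp (2 * (j : ℕ) * T) :=
      le_mul_of_one_le_right hcinv.le (one_le_exp (by positivity))
    refine h.exists_zero hα0 hα hc0 (by positivity) ?_ (hbδ.trans_lt hδρ) hbδ hm0 ?_ ?_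
    · gcongr
      linarith
    · intro x hx
      have hx' : x ∈ Ioo 0 ρ₁ :=
        ⟨hcinv.trans_le (ha.trans hx.1), (hx.2.trans hbδ).trans_lt hδρ⟩
      have h1 := h.A_antitoneOn hα0 ⟨hcinv, hcδ.trans_lt hδρ⟩ hx' (ha.trans hx.1)
      have h2 := h.one_sub_A_le hα0 hx'
      rw [hm, div_le_iff₀ (by linarith)]
      linarith
    · rw [log_mul hcinv.ne' (exp_ne_zero _), log_mul hcinv.ne' (exp_ne_zero _), log_exp,
        log_exp]
      linarith
  choose z hz hz0 using hzero
  have hzmono : StrictMono z := fun i j hij => by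
    refine (hz i).2.trans_lt (lt_of_lt_of_le ?_ (hz j).1)
    have : ((i : ℕ) : ℝ) + 1 ≤ (j : ℕ) := by exact_mod_cast hij
    gcongr
    linarith
  refine ⟨Finset.univ.map ⟨z, hzmono.injective⟩, by simp, fun ρ hρ => ?_⟩
  obtain ⟨j, -, rfl⟩ := Finset.mem_map.mp hρ
  refine ⟨⟨lt_of_lt_of_le (by positivity) (hz j).1, ?_⟩, hz0 j⟩
  refine (hz j).2.trans_lt (lt_of_le_of_lt (le_trans ?_ hscale) hδs)
  have hjk : ((j : ℕ) : ℝ) + 1 ≤ k := by exact_mod_cast j.2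
  gcongr
  linarith
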